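/- Let n ≥ 5 be an odd integer. Then the graph obtained from the cycle C_{n−1} by attaching one pendant edge is an almost self-centered graph of order n with girth n−1, and every almost self-centered graph of order n has girth at most n−1. Hence the maximum girth of an almost self-centered graph of order n is n−1. -/

import Mathlib

open SimpleGraph

/-- The eccentricity of a vertex `v`: the maximum distance from `v` to any vertex. -/
noncomputable def graphEcc {V : Type*} [Fintype V] (G : SimpleGraph V) (v : V) : ℕ :=
  Finset.univ.sup fun u => G.dist v u

/-- The radius of a graph: the minimum eccentricity over all vertices. -/
noncomputable def graphRadius {V : Type*} [Fintype V] (G : SimpleGraph V) : ℕ :=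
  sInf (Set.range (graphEcc G))

/-- The diameter of a graph: the maximum eccentricity over all vertices. -/
noncomputable def graphDiam {V : Type*} [Fintype V] (G : SimpleGraph V) : ℕ :=
  Finset.univ.sup (graphEcc G)

/-- A connected graph of order `n` is almost self-centered if it has exactly `n - 2`
central vertices (vertices whose eccentricity equals the radius). -/
def IsAlmostSelfCentered {V : Type*} [Fintype V] (G : SimpleGraph V) : Prop :=
  G.Connected ∧ Nat.card {v : V | graphEcc G v = graphRadius G} = Fintype.card V - 2

/-- A connected graph of order `n` is almost peripheral if it has exactly `n - 1`
peripheral vertices (vertices whose eccentricity equals the diameter). -/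
def IsAlmostPeripheral {V : Type*} [Fintype V] (G : SimpleGraph V) : Prop :=
  G.Connected ∧ Nat.card {v : V | graphEcc G v = graphDiam G} = Fintype.card V - 1

/-- The graph obtained from the cycle `C_m` by attaching one pendant edge:
a new vertex is joined to exactly one vertex of the cycle. -/
def cyclePlusPendant (m : ℕ) : SimpleGraph (Fin m ⊕ Unit) :=
  SimpleGraph.fromRel fun a b =>
    match a, b with
    | Sum.inl i, Sum.inl j => (SimpleGraph.cycleGraph m).Adj i j
    | Sum.inl i, Sum.inr _ => (i : ℕ) = 0
    | _, _ => False


theorem cyc_adj {m : ℕ} (hm : 3 ≤ m) (i j : Fin m) :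
    (cycleGraph m).Adj i j ↔ ((i : ℕ) + 1 = j ∨ (j : ℕ) + 1 = i ∨
      ((i : ℕ) = 0 ∧ (j : ℕ) + 1 = m) ∨ ((j : ℕ) = 0 ∧ (i : ℕ) + 1 = m)) := by
  rw [cycleGraph_adj', Fin.val_sub, Fin.val_sub]
  have key : ∀ a b : ℕ, a < m → b < m →
      ((m - b + a) % m = 1 ↔ (b + 1 = a ∨ (a = 0 ∧ b + 1 = m))) := by
    intro a b ha hb
    rcases le_or_gt b a with h | h
    · rw [show m - b + a = (a - b) + m by omega, Nat.add_mod_right,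
        Nat.mod_eq_of_lt (by omega)]
      omega
    · rw [Nat.mod_eq_of_lt (by omega)]
      omega
  rw [key _ _ i.2 j.2, key _ _ j.2 i.2]
  omega

theorem reach_of_descent {V : Type*} {G : SimpleGraph V} (v : V) (f : V → ℕ)
    (h0 : ∀ u, f u = 0 → u = v)
    (hd : ∀ u, f u ≠ 0 → ∃ w, G.Adj u w ∧ f w + 1 = f u) (k : ℕ) :
    ∀ u, f u = k → ∃ p : G.Walk u v, p.length = k := by
  induction k with
  | zero => intro u hu; obtain rfl := h0 u hu; exact ⟨Walk.nil, rfl⟩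
  | succ k ih =>
    intro u hu
    obtain ⟨w, hw, hfw⟩ := hd u (by omega)
    obtain ⟨p, hp⟩ := ih w (by omega)
    exact ⟨Walk.cons hw p, by simp [hp]⟩

theorem lip_walk {V : Type*} {G : SimpleGraph V} (f : V → ℕ)
    (hl : ∀ a b, G.Adj a b → f a ≤ f b + 1) {u v : V} (p : G.Walk u v) :
    f u ≤ f v + p.length := by
  induction p with
  | nil => simp
  | cons h q ih => have := hl _ _ h; simp only [Walk.length_cons]; omega

theorem dist_of_descent {V : Type*} {G : SimpleGraph V} (v : V) (f : V → ℕ)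
    (hv : f v = 0) (h0 : ∀ u, f u = 0 → u = v)
    (hd : ∀ u, f u ≠ 0 → ∃ w, G.Adj u w ∧ f w + 1 = f u)
    (hl : ∀ a b, G.Adj a b → f a ≤ f b + 1) (u : V) : G.dist v u = f u := by
  rw [dist_comm]
  obtain ⟨p, hp⟩ := reach_of_descent v f h0 hd _ u rfl
  apply le_antisymm
  · rw [← hp]; exact dist_le p
  · obtain ⟨q, hq⟩ := Reachable.exists_walk_length_eq_dist ⟨p⟩
    have := lip_walk f hl q
    omega

theorem cpp_ll {m : ℕ} (i j : Fin m) :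
    (cyclePlusPendant m).Adj (Sum.inl i) (Sum.inl j) ↔ (cycleGraph m).Adj i j := by
  simp only [cyclePlusPendant, fromRel_adj, ne_eq, Sum.inl.injEq]
  constructor
  · rintro ⟨_, h | h⟩
    · exact h
    · exact h.symm
  · intro h; exact ⟨h.ne, Or.inl h⟩

theorem cpp_lr {m : ℕ} (i : Fin m) (x : Unit) :
    (cyclePlusPendant m).Adj (Sum.inl i) (Sum.inr x) ↔ (i : ℕ) = 0 := by
  simp [cyclePlusPendant]

theorem cpp_rl {m : ℕ} (i : Fin m) (x : Unit) :
    (cyclePlusPendant m).Adj (Sum.inr x) (Sum.inl i) ↔ (i : ℕ) = 0 := by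
  rw [adj_comm, cpp_lr]

theorem cpp_rr {m : ℕ} (x y : Unit) :
    ¬ (cyclePlusPendant m).Adj (Sum.inr x) (Sum.inr y) := by
  simp [cyclePlusPendant]

def circ (m i j : ℕ) : ℕ := min ((i - j) + (j - i)) (m - ((i - j) + (j - i)))

def fl (m i : ℕ) : Fin m ⊕ Unit → ℕ
  | Sum.inl j => circ m i j
  | Sum.inr _ => circ m i 0 + 1

def fr (m : ℕ) : Fin m ⊕ Unit → ℕ
  | Sum.inl j => circ m 0 j + 1
  | Sum.inr _ => 0

theorem circ_desc {m : ℕ} (hm : 3 ≤ m) (i j : Fin m) (h : circ m i j ≠ 0) :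
    ∃ k : Fin m, (cycleGraph m).Adj j k ∧ circ m i k + 1 = circ m i j := by
  have hi := i.2
  have hj := j.2
  simp only [cyc_adj hm]
  unfold circ at *
  by_cases hji : (j : ℕ) < i
  · by_cases hh : (i : ℕ) - j ≤ m - (i - j)
    · exact ⟨⟨j + 1, by omega⟩, by simp, by simp only; omega⟩
    · by_cases hz : (j : ℕ) = 0
      · exact ⟨⟨m - 1, by omega⟩, by simp only; omega, by simp only; omega⟩
      · exact ⟨⟨j - 1, by omega⟩, by simp only; omega, by simp only; omega⟩
  · by_cases hh : (j : ℕ) - i ≤ m - (j - i)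
    · have hjp : 0 < (j : ℕ) := by omega
      exact ⟨⟨j - 1, by omega⟩, by simp only; omega, by simp only; omega⟩
    · by_cases hz : (j : ℕ) + 1 = m
      · exact ⟨⟨0, by omega⟩, Or.inr (Or.inr (Or.inr ⟨rfl, hz⟩)), by simp only; omega⟩
      · exact ⟨⟨j + 1, by omega⟩, by simp, by simp only; omega⟩

theorem circ_lip {m : ℕ} (hm : 3 ≤ m) (i j k : Fin m) (h : (cycleGraph m).Adj j k) :
    circ m i j ≤ circ m i k + 1 := by
  rw [cyc_adj hm] at h
  unfold circ
  omega

theorem circ_zero {m : ℕ} (i j : Fin m) (h : circ m i j = 0) : j = i := by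
  unfold circ at h
  ext
  omega

theorem dist_l {m : ℕ} (hm : 3 ≤ m) (i : Fin m) (u) :
    (cyclePlusPendant m).dist (Sum.inl i) u = fl m i u := by
  apply dist_of_descent
  · simp [fl, circ]
  · rintro (j | x) h
    · rw [circ_zero i j h]
    · simp [fl] at h
  · rintro (j | x) h
    · obtain ⟨k, hk, hk'⟩ := circ_desc hm i j h
      exact ⟨Sum.inl k, (cpp_ll _ _).2 hk, hk'⟩
    · exact ⟨Sum.inl ⟨0, by omega⟩, by rw [cpp_rl], rfl⟩
  · rintro (j | x) (k | y) h
    · exact circ_lip hm i j k ((cpp_ll _ _).1 h)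
    · rw [cpp_lr] at h; simp only [fl, h]; omega
    · rw [cpp_rl] at h; simp only [fl, h]; omega
    · exact absurd h (cpp_rr _ _)

theorem dist_r {m : ℕ} (hm : 3 ≤ m) (x : Unit) (u) :
    (cyclePlusPendant m).dist (Sum.inr x) u = fr m u := by
  apply dist_of_descent
  · simp [fr]
  · rintro (j | x) h
    · simp [fr] at h
    · rfl
  · rintro (j | x) h
    · by_cases hj : circ m 0 j = 0
      · refine ⟨Sum.inr x, (cpp_lr _ _).2 ?_, by simp [fr, hj]⟩
        have := circ_zero ⟨0, by omega⟩ j hj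
        simp [this]
      · obtain ⟨k, hk, hk'⟩ := circ_desc hm ⟨0, by omega⟩ j hj
        refine ⟨Sum.inl k, (cpp_ll _ _).2 hk, ?_⟩
        simp only [fr] at *
        omega
    · simp [fr] at h
  · rintro (j | x) (k | y) h
    · have := circ_lip hm ⟨0, by omega⟩ j k ((cpp_ll _ _).1 h)
      simp only [fr] at *
      omega
    · rw [cpp_lr] at h; simp [fr, h, circ]
    · simp [fr]
    · exact absurd h (cpp_rr _ _)

theorem cpp_connected {m : ℕ} (hm : 3 ≤ m) : (cyclePlusPendant m).Connected := by
  have : Nonempty (Fin m ⊕ Unit) := ⟨Sum.inr ()⟩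
  refine ⟨fun a b => ?_⟩
  have h : ∀ a, (cyclePlusPendant m).Reachable (Sum.inr ()) a := by
    intro a
    by_cases ha : a = Sum.inr ()
    · rw [ha]
    · apply Reachable.of_dist_ne_zero
      rw [dist_r hm]
      rcases a with j | x
      · simp [fr]
      · exact absurd rfl ha
  exact (h a).symm.trans (h b)

theorem ecc_eq {V : Type*} [Fintype V] (G : SimpleGraph V) (v : V) (k : ℕ)
    (h1 : ∀ u, G.dist v u ≤ k) (h2 : ∃ u, G.dist v u = k) : graphEcc G v = k := by
  apply le_antisymm
  · exact Finset.sup_le fun u _ => h1 u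
  · obtain ⟨u, hu⟩ := h2
    rw [← hu]
    exact Finset.le_sup (f := fun u => G.dist v u) (Finset.mem_univ u)

theorem ecc_l {k : ℕ} (hk : 2 ≤ k) (i : Fin (2 * k)) :
    graphEcc (cyclePlusPendant (2 * k)) (Sum.inl i) = if (i : ℕ) = k then k + 1 else k := by
  have hi := i.2
  apply ecc_eq
  · intro u
    rw [dist_l (by omega)]
    rcases u with j | x
    · have hj := j.2
      simp only [fl, circ]; split_ifs <;> omega
    · simp only [fl, circ]; split_ifs <;> omega
  · simp only [dist_l (show 3 ≤ 2 * k by omega)]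
    by_cases h : (i : ℕ) = k
    · refine ⟨Sum.inr (), ?_⟩
      simp only [fl, circ, h]; simp; omega
    · by_cases h' : (i : ℕ) < k
      · refine ⟨Sum.inl ⟨i + k, by omega⟩, ?_⟩
        simp only [fl, circ]; rw [if_neg h]; omega
      · refine ⟨Sum.inl ⟨i - k, by omega⟩, ?_⟩
        simp only [fl, circ]; rw [if_neg h]; omega

theorem ecc_r {k : ℕ} (hk : 2 ≤ k) (x : Unit) :
    graphEcc (cyclePlusPendant (2 * k)) (Sum.inr x) = k + 1 := by
  apply ecc_eq
  · intro u
    rw [dist_r (by omega)]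
    rcases u with j | x
    · have hj := j.2
      simp only [fr, circ]; omega
    · simp only [fr]; omega
  · simp only [dist_r (show 3 ≤ 2 * k by omega)]
    refine ⟨Sum.inl ⟨k, by omega⟩, ?_⟩
    simp only [fr, circ]; omega

theorem cpp_radius {k : ℕ} (hk : 2 ≤ k) : graphRadius (cyclePlusPendant (2 * k)) = k := by
  apply le_antisymm
  · apply Nat.sInf_le
    refine ⟨Sum.inl ⟨0, by omega⟩, ?_⟩
    rw [ecc_l hk, if_neg]
    simp only; omega
  · apply le_csInf (Set.range_nonempty_iff_nonempty.2 ⟨Sum.inr ()⟩)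
    rintro _ ⟨i | x, rfl⟩
    · rw [ecc_l hk]; split_ifs <;> omega
    · rw [ecc_r hk]; omega

theorem cpp_asc {k : ℕ} (hk : 2 ≤ k) : IsAlmostSelfCentered (cyclePlusPendant (2 * k)) := by
  refine ⟨cpp_connected (by omega), ?_⟩
  rw [cpp_radius hk]
  have : {v | graphEcc (cyclePlusPendant (2 * k)) v = k}
      = (↑({Sum.inl ⟨k, by omega⟩, Sum.inr ()}ᶜ : Finset (Fin (2 * k) ⊕ Unit)) : Set _) := by
    ext v
    rcases v with i | x
    · simp only [Set.mem_ofPred_eq, ecc_l hk]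
      simp [Fin.ext_iff]
    · simp [ecc_r hk]
  rw [this]
  simp only [Finset.coe_sort_coe, Nat.card_eq_fintype_card, Fintype.card_coe]
  rw [Finset.card_compl, Finset.card_pair (by simp)]

theorem cpp_cycle_mem {m : ℕ} (hm : 3 ≤ m) {a} (w : (cyclePlusPendant m).Walk a a)
    (hw : w.IsCycle) : ∀ i : Fin m, Sum.inl i ∈ w.support := by
  classical
  have two : ∀ v ∈ w.support, ∃ x y, x ≠ y ∧ x ∈ w.support ∧ y ∈ w.support ∧
      (cyclePlusPendant m).Adj v x ∧ (cyclePlusPendant m).Adj v y := by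
    intro v hv
    have := hw.ncard_neighborSet_toSubgraph_eq_two hv
    obtain ⟨x, y, hxy, he⟩ := Set.ncard_eq_two.1 this
    have hx : x ∈ w.toSubgraph.neighborSet v := by rw [he]; simp
    have hy : y ∈ w.toSubgraph.neighborSet v := by rw [he]; simp
    exact ⟨x, y, hxy, w.mem_verts_toSubgraph.1 (w.toSubgraph.edge_vert hx.symm),
      w.mem_verts_toSubgraph.1 (w.toSubgraph.edge_vert hy.symm),
      w.toSubgraph.adj_sub hx, w.toSubgraph.adj_sub hy⟩
  have nor : ∀ x, Sum.inr x ∉ w.support := by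
    intro x hx
    obtain ⟨p, q, hpq, -, -, hp, hq⟩ := two _ hx
    rcases p with p | p
    · rcases q with q | q
      · rw [cpp_rl] at hp hq
        exact hpq (by congr 1; ext; omega)
      · exact cpp_rr _ _ hq
    · exact cpp_rr _ _ hp
  have step : ∀ i : Fin m, Sum.inl i ∈ w.support → ∀ j : Fin m, (j : ℕ) + 1 = i →
      Sum.inl j ∈ w.support := by
    intro i hi j hj
    obtain ⟨p, q, hpq, hp', hq', hp, hq⟩ := two _ hi
    rcases p with p | p
    swap
    · exact absurd hp' (nor _)
    rcases q with q | q
    swap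
    · exact absurd hq' (nor _)
    rw [cpp_ll, cyc_adj hm] at hp hq
    have hne : (p : ℕ) ≠ q := fun h => hpq (by congr 1; ext; exact h)
    have : (j : ℕ) = p ∨ (j : ℕ) = q := by omega
    rcases this with h | h
    · rwa [Fin.ext h]
    · rwa [Fin.ext h]
  have step0 : ∀ i : Fin m, Sum.inl i ∈ w.support → (i : ℕ) = 0 → ∀ j : Fin m, (j : ℕ) + 1 = m →
      Sum.inl j ∈ w.support := by
    intro i hi hi0 j hj
    obtain ⟨p, q, hpq, hp', hq', hp, hq⟩ := two _ hi
    rcases p with p | p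
    swap
    · exact absurd hp' (nor _)
    rcases q with q | q
    swap
    · exact absurd hq' (nor _)
    rw [cpp_ll, cyc_adj hm] at hp hq
    have hne : (p : ℕ) ≠ q := fun h => hpq (by congr 1; ext; exact h)
    have : (j : ℕ) = p ∨ (j : ℕ) = q := by omega
    rcases this with h | h
    · rwa [Fin.ext h]
    · rwa [Fin.ext h]
  have down : ∀ d : ℕ, ∀ i j : Fin m, (j : ℕ) + d = i → Sum.inl i ∈ w.support →
      Sum.inl j ∈ w.support := by
    intro d
    induction d with
    | zero => intro i j h hi; rwa [Fin.ext (show (j : ℕ) = i by omega)]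
    | succ d ih =>
      intro i j h hi
      exact ih ⟨i - 1, by omega⟩ j (by simp only; omega) (step i hi _ (by simp only; omega))
  have h0 : Sum.inl (⟨0, by omega⟩ : Fin m) ∈ w.support := by
    have := w.start_mem_support
    rcases a with i | x
    · exact down i i _ (by simp) this
    · exact absurd this (nor _)
  intro i
  exact down (m - 1 - i) ⟨m - 1, by omega⟩ i (by simp only; omega)
    (step0 _ h0 rfl _ (by simp only; omega))

theorem cpp_egirth {m : ℕ} (hm : 3 ≤ m) : (cyclePlusPendant m).egirth = (m : ℕ∞) := by
  apply le_antisymm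
  · have : cycleGraph m ⊑ cyclePlusPendant m :=
      ⟨⟨⟨Sum.inl, fun {a b} h => (cpp_ll a b).2 h⟩, Sum.inl_injective⟩⟩
    obtain ⟨v, c, hc, hl⟩ := (cycleGraph_isContained_iff (by omega)).1 this
    exact (egirth_le_length hc).trans (by rw [hl])
  · rw [le_egirth]
    intro a w hw
    have hmem := cpp_cycle_mem hm w hw
    classical
    have hmem' : ∀ i : Fin m, Sum.inl i ∈ w.support.tail := by
      intro i
      have := hmem i
      rw [Walk.mem_support_iff] at this
      rcases this with h | h
      · rw [h]; exact Walk.end_mem_tail_support hw.not_nil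
      · exact h
    have h1 : (Finset.univ.map ⟨Sum.inl, Sum.inl_injective⟩ : Finset (Fin m ⊕ Unit)) ⊆
        w.support.tail.toFinset := by
      intro x hx
      simp only [Finset.mem_map, Finset.mem_univ, true_and, Function.Embedding.coeFn_mk] at hx
      obtain ⟨i, rfl⟩ := hx
      exact List.mem_toFinset.2 (hmem' i)
    have h2 := Finset.card_le_card h1
    have h3 := w.support.tail.toFinset_card_le
    simp at h2 h3
    exact_mod_cast h2.trans h3

/-! Part 2 -/

theorem tree_closer_unique {V : Type*} {G : SimpleGraph V} (hG : G.IsTree) {x y z w : V}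
    (hx : G.Adj z x) (hy : G.Adj z y) (hxw : G.dist w z = G.dist w x + 1)
    (hyw : G.dist w z = G.dist w y + 1) : x = y := by
  obtain ⟨p, hp⟩ := hG.1.exists_walk_length_eq_dist x w
  obtain ⟨q, hq⟩ := hG.1.exists_walk_length_eq_dist y w
  rw [dist_comm] at hp hq
  have hp' : (Walk.cons hx p).IsPath := Walk.isPath_of_length_eq_dist _ (by
    rw [dist_comm, Walk.length_cons]; omega)
  have hq' : (Walk.cons hy q).IsPath := Walk.isPath_of_length_eq_dist _ (by
    rw [dist_comm, Walk.length_cons]; omega)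
  have := congrArg Subtype.val (hG.isAcyclic.path_unique ⟨_, hp'⟩ ⟨_, hq'⟩)
  simp only [Walk.cons.injEq] at this
  exact this.1

theorem tree_increase {V : Type*} {G : SimpleGraph V} (hG : G.IsTree) {z y : V} (w : V)
    (q : G.Walk z y) : ∀ x (h : G.Adj x z), (Walk.cons h q).IsPath →
      G.dist w z = G.dist w x + 1 → G.dist w y = G.dist w z + q.length := by
  induction q with
  | nil => simp
  | @cons z z' y h' q ih =>
    intro x h hp hd
    have hne : x ≠ z' := by
      rintro rfl
      rw [Walk.cons_isPath_iff] at hp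
      exact hp.2 (by simp)
    have hp' := hp.of_cons
    rcases hG.dist_eq_dist_add_one_of_adj w h' with h1 | h1
    · exact absurd (tree_closer_unique hG h.symm h' hd h1) hne
    · have := ih z h' hp' h1
      rw [Walk.length_cons]; omega

theorem dist_le_ecc {V : Type*} [Fintype V] (G : SimpleGraph V) (v u : V) :
    G.dist v u ≤ graphEcc G v :=
  Finset.le_sup (f := fun u => G.dist v u) (Finset.mem_univ u)

theorem radius_le {V : Type*} [Fintype V] (G : SimpleGraph V) (v : V) :
    graphRadius G ≤ graphEcc G v := Nat.sInf_le ⟨v, rfl⟩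

theorem tree_central_adj {V : Type*} [Fintype V] {G : SimpleGraph V} (hG : G.IsTree) {x y : V}
    (hx : graphEcc G x = graphRadius G) (hy : graphEcc G y = graphRadius G) (hne : x ≠ y) :
    G.Adj x y := by
  by_contra hna
  obtain ⟨p, hp, hl⟩ := hG.1.exists_path_of_dist x y
  have h1 := hG.1.one_lt_dist_of_ne_of_not_adj hne hna
  cases p with
  | nil => exact hne rfl
  | @cons _ z _ h q =>
    have hq : 1 ≤ q.length := by rw [Walk.length_cons] at hl; omega
    have : graphEcc G z < graphRadius G := by
      have hpos : 0 < graphRadius G := by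
        have := dist_le_ecc G x y
        omega
      refine (Finset.sup_lt_iff hpos).2 fun w _ => ?_
      have a1 := dist_le_ecc G x w
      have a2 := dist_le_ecc G y w
      rw [dist_comm] at a1 a2 ⊢
      rcases hG.dist_eq_dist_add_one_of_adj w h with h2 | h2
      · omega
      · have := tree_increase hG w q x h hp h2
        omega
    have := radius_le G z
    omega

theorem not_acyclic_of_asc {V : Type*} [Fintype V] {G : SimpleGraph V}
    (h5 : 5 ≤ Fintype.card V) (h : IsAlmostSelfCentered G) : ¬ G.IsAcyclic := by
  classical
  intro ha
  have hG : G.IsTree := ⟨h.1, ha⟩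
  have hc := h.2
  rw [Nat.card_coe_set_eq] at hc
  have h2 : 2 < Set.ncard {v : V | graphEcc G v = graphRadius G} := by omega
  rw [Set.two_lt_ncard_iff] at h2
  obtain ⟨a, b, c, hA, hB, hC, hab, hac, hbc⟩ := h2
  refine ha.cliqueFree le_rfl {a, b, c} ?_
  rw [is3Clique_triple_iff]
  exact ⟨tree_central_adj hG hA hB hab, tree_central_adj hG hA hC hac,
    tree_central_adj hG hB hC hbc⟩

theorem ecc_le_iso {V : Type*} [Fintype V] {G : SimpleGraph V} (hG : G.Connected)
    (e : G ≃g G) (v : V) : graphEcc G (e v) ≤ graphEcc G v := by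
  refine Finset.sup_le fun u _ => ?_
  obtain ⟨p, hp⟩ := hG.exists_walk_length_eq_dist v (e.symm u)
  have h1 := dist_le ((p.map e.toHom).copy rfl (show e (e.symm u) = u by simp))
  have h2 := dist_le_ecc G v (e.symm u)
  rw [Walk.length_copy, Walk.length_map, hp] at h1
  exact h1.trans h2

theorem cyc_rot {m : ℕ} (hm : 3 ≤ m) (i j : Fin m) :
    ∃ e : cycleGraph m ≃g cycleGraph m, e i = j := by
  have : NeZero m := ⟨by omega⟩
  refine ⟨⟨Equiv.addRight (j - i), ?_⟩, ?_⟩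
  · intro a b
    simp only [Equiv.coe_addRight, cycleGraph_adj', add_sub_add_right_eq_sub]
  · simp

theorem no_full_cycle {V : Type*} [Fintype V] {G : SimpleGraph V} {m : ℕ} (hm : 3 ≤ m)
    (hcard : Fintype.card V = m) (hG : IsAlmostSelfCentered G)
    (hc : cycleGraph m ⊑ G) (hg : (m : ℕ∞) ≤ G.egirth) : False := by
  obtain ⟨f⟩ := hc
  have hinj : Function.Injective f := f.injective
  have hbij : Function.Bijective f := by
    rw [Fintype.bijective_iff_injective_and_card]
    exact ⟨hinj, by simp [hcard]⟩
  have hadj : ∀ i j : Fin m, (cycleGraph m).Adj i j → G.Adj (f i) (f j) :=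
    fun i j h => f.toHom.map_adj h
  have chord : ∀ i j : Fin m, (i : ℕ) < j → G.Adj (f i) (f j) → (cycleGraph m).Adj i j := by
    intro i j hij h
    by_contra hn
    rw [cyc_adj hm] at hn
    have hi := i.2
    have hj := j.2
    have hl : 3 ≤ (j : ℕ) - i + 1 := by omega
    have hsub : cycleGraph ((j : ℕ) - i + 1) ⊑ G := by
      refine ⟨⟨⟨fun k => f ⟨i + k, by omega⟩, ?_⟩, ?_⟩⟩
      · intro a b hab
        rw [cyc_adj hl] at hab
        have ha := a.2
        have hb := b.2
        rcases hab with h1 | h1 | h1 | h1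
        · exact hadj _ _ ((cyc_adj hm _ _).2 (by simp only; omega))
        · exact hadj _ _ ((cyc_adj hm _ _).2 (by simp only; omega))
        · rw [show (⟨i + a, by omega⟩ : Fin m) = i by ext; simp only; omega,
            show (⟨i + b, by omega⟩ : Fin m) = j by ext; simp only; omega]
          exact h
        · rw [show (⟨i + b, by omega⟩ : Fin m) = i by ext; simp only; omega,
            show (⟨i + a, by omega⟩ : Fin m) = j by ext; simp only; omega]
          exact h.symm
      · intro a b hab
        have := congrArg Fin.val (hinj hab)
        ext
        simp only at this
        omega
    obtain ⟨v, c, hc, hlen⟩ := (cycleGraph_isContained_iff (by omega)).1 hsub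
    have h1 := hg.trans (egirth_le_length hc)
    rw [hlen] at h1
    have h2 : m ≤ (j : ℕ) - i + 1 := by exact_mod_cast h1
    omega
  have hiff : ∀ i j : Fin m, G.Adj (f i) (f j) ↔ (cycleGraph m).Adj i j := by
    intro i j
    refine ⟨fun h => ?_, hadj i j⟩
    rcases lt_trichotomy (i : ℕ) j with h1 | h1 | h1
    · exact chord i j h1 h
    · rw [Fin.ext h1] at h; exact absurd h (G.loopless.irrefl _)
    · exact (chord j i h1 h.symm).symm
  let e : cycleGraph m ≃g G := ⟨Equiv.ofBijective f hbij, fun {a b} => hiff a b⟩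
  have htrans : ∀ u v : V, graphEcc G v ≤ graphEcc G u := by
    intro u v
    obtain ⟨r, hr⟩ := cyc_rot hm (e.symm u) (e.symm v)
    have := ecc_le_iso hG.1 ((e.symm.trans r).trans e) u
    have h2 : ((e.symm.trans r).trans e) u = v := by
      simp [RelIso.trans_apply, hr]
    rwa [h2] at this
  have hall : {v : V | graphEcc G v = graphRadius G} = Set.univ := by
    ext v
    simp only [Set.mem_ofPred_eq, Set.mem_univ, iff_true]
    apply le_antisymm _ (radius_le G v)
    refine le_csInf (Set.range_nonempty_iff_nonempty.2 ⟨v⟩) ?_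
    rintro _ ⟨u, rfl⟩
    exact htrans u v
  have := hG.2
  rw [hall, Nat.card_coe_set_eq, Set.ncard_univ, Nat.card_eq_fintype_card] at this
  omega

theorem max_girth_of_almostSelfCentered_odd (n : ℕ) (h5 : 5 ≤ n) (hodd : Odd n) :
    (IsAlmostSelfCentered (cyclePlusPendant (n - 1)) ∧
      Fintype.card (Fin (n - 1) ⊕ Unit) = n ∧
      (cyclePlusPendant (n - 1)).egirth = ((n - 1 : ℕ) : ℕ∞)) ∧
    (∀ (V : Type) [Fintype V] (G : SimpleGraph V), Fintype.card V = n →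
      IsAlmostSelfCentered G → G.egirth ≤ ((n - 1 : ℕ) : ℕ∞)) := by
  refine ⟨⟨?_, ?_, cpp_egirth (by omega)⟩, ?_⟩
  · obtain ⟨k, rfl⟩ := hodd
    exact cpp_asc (k := k) (by omega)
  · simp; omega
  · intro V _ G hV hG
    by_contra hlt
    rw [not_le] at hlt
    obtain ⟨a, w, hw, hlen⟩ := exists_egirth_eq_length.2 (not_acyclic_of_asc (by omega) hG)
    rw [hlen] at hlt
    have h1 : n - 1 < w.length := by exact_mod_cast hlt
    have h2 : w.length ≤ n := by
      have := hw.support_nodup.length_le_card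
      simp at this
      omega
    have h3 : w.length = n := by omega
    refine no_full_cycle (m := n) (by omega) hV hG
      ((cycleGraph_isContained_iff (by omega)).2 ⟨a, w, hw, h3⟩) ?_
    rw [hlen, h3]
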